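/- For every real p > 1, the critical determinant of D_p = {(x, y) ∈ ℝ² : |x|^p + |y|^p < 1} satisfies Δ(D_p) ≤ σ_p/2, where σ_p = (2^p − 1)^{1/p}. -/

import Mathlib

noncomputable section

/-- `σ_p = (2^p - 1)^(1/p)`. -/
def sigmaP (p : ℝ) : ℝ := (2 ^ p - 1) ^ (1 / p)

/-- The region `D_p = {(x,y) : |x|^p + |y|^p < 1}`. -/
def Dp (p : ℝ) : Set (ℝ × ℝ) := {x | |x.1| ^ p + |x.2| ^ p < 1}

/-- The lattice (ℤ-span) generated by two vectors `v, w ∈ ℝ²`. -/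
def latticePts (v w : ℝ × ℝ) : Set (ℝ × ℝ) :=
  {x | ∃ m n : ℤ, x = (m : ℝ) • v + (n : ℝ) • w}

/-- The lattice spanned by `v, w` (linearly independent over `ℝ`) is
admissible for `D_p` if it meets `D_p` only in `0`. -/
def IsAdmissible (p : ℝ) (v w : ℝ × ℝ) : Prop :=
  LinearIndependent ℝ ![v, w] ∧ Dp p ∩ latticePts v w ⊆ {0}

/-- Determinant of the basis `v, w` of a planar lattice. -/
def det2 (v w : ℝ × ℝ) : ℝ := v.1 * w.2 - v.2 * w.1

/-- The critical determinant of `D_p`: the infimum of `|det(v,w)|` over all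
admissible lattices for `D_p`. -/
def criticalDet (p : ℝ) : ℝ :=
  sInf {d : ℝ | ∃ v w : ℝ × ℝ, IsAdmissible p v w ∧ d = |det2 v w|}

theorem sigmaP_pos {p : ℝ} (hp : 1 < p) : 0 < sigmaP p :=
  Real.rpow_pos_of_pos (by linarith [Real.one_lt_rpow one_lt_two (by linarith : 0 < p)]) _

theorem sigmaP_rpow {p : ℝ} (hp : 1 < p) : sigmaP p ^ p = 2 ^ p - 1 := by
  have h : (1 : ℝ) < 2 ^ p := Real.one_lt_rpow one_lt_two (by linarith)
  rw [sigmaP, ← Real.rpow_mul (by linarith), one_div_mul_cancel (by linarith), Real.rpow_one]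

/-- Nonzero points of the lattice spanned by `(1, 0)` and `(1/2, σ_p/2)` lie outside `D_p`. -/
theorem one_le_rpow_add_rpow {p : ℝ} (hp : 1 < p) {m n : ℤ} (hmn : m ≠ 0 ∨ n ≠ 0) :
    1 ≤ |(m : ℝ) + n / 2| ^ p + |n * (sigmaP p / 2)| ^ p := by
  have hp0 : 0 ≤ p := by linarith
  have h2 : (2 : ℝ) ≤ 2 ^ p := by
    simpa using Real.rpow_le_rpow_of_exponent_le one_le_two hp.le
  have hσ := sigmaP_pos hp
  have hx : 0 ≤ |(m : ℝ) + n / 2| ^ p := by positivity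
  have hy : 0 ≤ |n * (sigmaP p / 2)| ^ p := by positivity
  rcases eq_or_ne n 0 with rfl | hn
  · have hm : (1 : ℝ) ≤ |(m : ℝ)| := by
      exact_mod_cast Int.one_le_abs (hmn.resolve_right (by simp))
    have := Real.one_le_rpow hm hp0
    simp only [Int.cast_zero, zero_div, add_zero] at hx ⊢
    linarith
  rcases le_or_gt 2 |n| with hn2 | hn2
  · have hn2 : (2 : ℝ) ≤ |(n : ℝ)| := by exact_mod_cast hn2
    have hle : sigmaP p ≤ |n * (sigmaP p / 2)| := by
      rw [abs_mul, abs_of_pos (half_pos hσ)]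
      nlinarith
    have := Real.rpow_le_rpow hσ.le hle hp0
    rw [sigmaP_rpow hp] at this
    linarith
  · have hn1 : |n| = 1 := le_antisymm (by omega) (Int.one_le_abs hn)
    have hodd : 1 ≤ |2 * m + n| := Int.one_le_abs (by
      rcases (abs_eq zero_le_one).1 hn1 with h | h <;> omega)
    have hodd : (1 : ℝ) ≤ |2 * (m : ℝ) + n| := by exact_mod_cast hodd
    have hhalf : 1 / 2 ≤ |(m : ℝ) + n / 2| := by
      rw [show (m : ℝ) + n / 2 = (2 * m + n) / 2 by ring, abs_div, abs_two]
      linarith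
    have hn1 : |(n : ℝ)| = 1 := by exact_mod_cast hn1
    have hfst := Real.rpow_le_rpow (by norm_num) hhalf hp0
    rw [Real.div_rpow zero_le_one zero_le_two, Real.one_rpow] at hfst
    have hsnd : |n * (sigmaP p / 2)| ^ p = (2 ^ p - 1) / 2 ^ p := by
      rw [abs_mul, hn1, one_mul, abs_of_pos (half_pos hσ), Real.div_rpow hσ.le zero_le_two,
        sigmaP_rpow hp]
    have hsum : 1 / (2 : ℝ) ^ p + (2 ^ p - 1) / 2 ^ p = 1 := by
      field_simp
      ring
    linarith

theorem isAdmissible_one_zero_half_sigmaP {p : ℝ} (hp : 1 < p) :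
    IsAdmissible p (1, 0) (1 / 2, sigmaP p / 2) := by
  have hσ := sigmaP_pos hp
  refine ⟨LinearIndependent.pair_iff.2 fun s t h => ?_, ?_⟩
  · simp only [Prod.smul_mk, Prod.mk_add_mk, smul_eq_mul, Prod.mk_eq_zero] at h
    obtain ⟨h1, h2⟩ := h
    have ht : t = 0 := by simpa [hσ.ne'] using h2
    subst ht
    exact ⟨by simpa using h1, rfl⟩
  · rintro _ ⟨hx, m, n, rfl⟩
    by_contra hne
    have hmn : m ≠ 0 ∨ n ≠ 0 := by
      by_contra! h
      exact hne (by simp [h.1, h.2])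
    have hle := one_le_rpow_add_rpow hp hmn
    simp only [Dp, Set.mem_ofPred_eq, Prod.smul_mk, Prod.mk_add_mk, smul_eq_mul, mul_one, mul_zero,
      zero_add, mul_one_div] at hx
    linarith

/-- For every `p > 1`, the critical determinant of `D_p` is at most `σ_p / 2`. -/
theorem criticalDet_le (p : ℝ) (hp : 1 < p) :
    criticalDet p ≤ sigmaP p / 2 := by
  refine csInf_le ⟨0, ?_⟩ ⟨_, _, isAdmissible_one_zero_half_sigmaP hp, ?_⟩
  · rintro _ ⟨v, w, -, rfl⟩
    exact abs_nonneg _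
  · simp [det2, abs_of_pos (half_pos (sigmaP_pos hp))]
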